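/- arXiv:2603.18215 — 3 statements merged into one kernel-verified Lean document; each statement's English description precedes it below -/
import Mathlib

section
/- Let $n, k$ be natural numbers with $k \le n$. Let $S^z_{n,k}$ be the set of all symmetric positive semidefinite matrices $X \in \mathbb{R}^{n\times n}$ for which there exists $z \in \mathbb{R}^n$ such that \[ \|X_{i,:}\|_2^2 \le X_{ii} z_i, \qquad \|X_{i,:}\|_1^2 \le k X_{ii} z_i, \qquad 0 \le z_i \le \operatorname{tr}(X) \qquad \text{for all } i \in \{1,\dots,n\}, \] and $\sum_{i=1}^n z_i = k \operatorname{tr}(X)$, where $X_{i,:}$ is the $i$-th row of $X$. Then for every vector $x \in \mathbb{R}^n$, the rank-one matrix $x x^T$ belongs to $S^z_{n,k}$ if and only if $\|x\|_0 \le k$, where $\|x\|_0$ is the number of nonzero entries of $x$. -/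
/-- The number `‖x‖₀` of nonzero entries of a vector. -/
noncomputable def sparsity {n : ℕ} (x : Fin n → ℝ) : ℕ :=
  (Finset.univ.filter fun i => x i ≠ 0).card

/-- The cone `S^z_{n,k}` of positive semidefinite (in particular symmetric) matrices. The two sums
over `j` are the squared `ℓ₂`-norm and the `ℓ₁`-norm of the `i`-th row of `X`. -/
def Sz (n k : ℕ) : Set (Matrix (Fin n) (Fin n) ℝ) :=
  {X | X.PosSemidef ∧ ∃ z : Fin n → ℝ,
    (∀ i, (∑ j, (X i j) ^ 2) ≤ X i i * z i) ∧
    (∀ i, (∑ j, |X i j|) ^ 2 ≤ (k : ℝ) * (X i i * z i)) ∧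
    (∀ i, 0 ≤ z i ∧ z i ≤ X.trace) ∧
    (∑ i, z i) = (k : ℝ) * X.trace}

theorem sum_sq_row_vecMulVec_self {n : ℕ} (x : Fin n → ℝ) (i : Fin n) :
    ∑ j, (Matrix.vecMulVec x x i j) ^ 2 = x i * x i * (Matrix.vecMulVec x x).trace := by
  simp only [Matrix.trace, Matrix.diag_apply, Matrix.vecMulVec_apply, Finset.mul_sum]
  exact Finset.sum_congr rfl fun j _ => by ring

theorem sq_sum_abs_row_vecMulVec_self {n : ℕ} (x : Fin n → ℝ) (i : Fin n) :
    (∑ j, |Matrix.vecMulVec x x i j|) ^ 2 = x i * x i * (∑ j, |x j|) ^ 2 := by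
  simp only [Matrix.vecMulVec_apply, abs_mul, ← Finset.mul_sum, mul_pow, sq_abs]
  ring

theorem trace_vecMulVec_self_nonneg {n : ℕ} (x : Fin n → ℝ) :
    0 ≤ (Matrix.vecMulVec x x).trace :=
  Finset.sum_nonneg fun i _ => mul_self_nonneg (x i)

theorem trace_vecMulVec_self_pos {n : ℕ} {x : Fin n → ℝ} {i : Fin n} (hi : x i ≠ 0) :
    0 < (Matrix.vecMulVec x x).trace :=
  Finset.sum_pos' (fun j _ => mul_self_nonneg (x j))
    ⟨i, Finset.mem_univ i, mul_self_pos.mpr hi⟩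

/-- The Cauchy–Schwarz bound `‖x‖₁² ≤ ‖x‖₀ ‖x‖₂²`. -/
theorem sq_sum_abs_le_sparsity_mul {n : ℕ} (x : Fin n → ℝ) :
    (∑ j, |x j|) ^ 2 ≤ sparsity x * (Matrix.vecMulVec x x).trace := by
  have hsum : ∑ j, |x j| = ∑ j with x j ≠ 0, |x j| :=
    (Finset.sum_filter_of_ne fun j _ hj => abs_ne_zero.mp hj).symm
  rw [hsum]
  refine (sq_sum_le_card_mul_sum_sq).trans ?_
  refine mul_le_mul_of_nonneg_left ?_ (Nat.cast_nonneg _)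
  calc ∑ j with x j ≠ 0, |x j| ^ 2 ≤ ∑ j, |x j| ^ 2 :=
        Finset.sum_le_sum_of_subset_of_nonneg (Finset.filter_subset _ _)
          fun j _ _ => sq_nonneg _
    _ = (Matrix.vecMulVec x x).trace :=
        Finset.sum_congr rfl fun j _ => by
          rw [sq_abs, Matrix.diag_apply, Matrix.vecMulVec_apply, sq]

theorem sparsity_le_of_vecMulVec_mem_Sz {n k : ℕ} {x : Fin n → ℝ}
    (h : Matrix.vecMulVec x x ∈ Sz n k) : sparsity x ≤ k := by
  obtain ⟨-, z, h2, -, hz, hsum⟩ := h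
  rcases (Finset.univ.filter fun i => x i ≠ 0).eq_empty_or_nonempty with he | ⟨i₀, hi₀⟩
  · simp [sparsity, he]
  have hT := trace_vecMulVec_self_pos (Finset.mem_filter.mp hi₀).2
  have hle : ∀ i ∈ Finset.univ.filter (fun i => x i ≠ 0),
      (Matrix.vecMulVec x x).trace ≤ z i := fun i hi => by
    have hrow := h2 i
    rw [sum_sq_row_vecMulVec_self, Matrix.vecMulVec_apply] at hrow
    exact le_of_mul_le_mul_left hrow (mul_self_pos.mpr (Finset.mem_filter.mp hi).2)
  have hmul : (sparsity x : ℝ) * (Matrix.vecMulVec x x).trace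
      ≤ k * (Matrix.vecMulVec x x).trace := by
    rw [← hsum, ← nsmul_eq_mul]
    exact (Finset.card_nsmul_le_sum _ _ _ hle).trans
      (Finset.sum_le_sum_of_subset_of_nonneg (Finset.filter_subset _ _) fun i _ _ => (hz i).1)
  exact_mod_cast le_of_mul_le_mul_right hmul hT

theorem vecMulVec_mem_Sz_of_sparsity_le {n k : ℕ} (hkn : k ≤ n) {x : Fin n → ℝ}
    (h : sparsity x ≤ k) : Matrix.vecMulVec x x ∈ Sz n k := by
  obtain ⟨A, hA, -, hcard⟩ := Finset.exists_subsuperset_card_eq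
    (Finset.filter_subset (fun i => x i ≠ 0) Finset.univ) h (by simpa using hkn)
  have hT := trace_vecMulVec_self_nonneg x
  have hz : ∀ i, x i * x i * (if i ∈ A then (Matrix.vecMulVec x x).trace else 0)
      = x i * x i * (Matrix.vecMulVec x x).trace := fun i => by
    by_cases hi : x i = 0
    · simp [hi]
    · rw [if_pos (hA (Finset.mem_filter.mpr ⟨Finset.mem_univ i, hi⟩))]
  refine ⟨by simpa using Matrix.posSemidef_vecMulVec_self_star x,
    fun i => if i ∈ A then (Matrix.vecMulVec x x).trace else 0, fun i => ?_, fun i => ?_,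
    fun i => ?_, ?_⟩
  · rw [sum_sq_row_vecMulVec_self, Matrix.vecMulVec_apply, hz]
  · rw [sq_sum_abs_row_vecMulVec_self, Matrix.vecMulVec_apply, hz, mul_left_comm]
    refine mul_le_mul_of_nonneg_left ((sq_sum_abs_le_sparsity_mul x).trans ?_)
      (mul_self_nonneg _)
    exact mul_le_mul_of_nonneg_right (Nat.cast_le.mpr h) hT
  · dsimp only
    split_ifs
    · exact ⟨hT, le_rfl⟩
    · exact ⟨le_rfl, hT⟩
  · simp [Finset.sum_ite_mem, hcard]

theorem Sz_rank_one_mem_iff (n k : ℕ) (hkn : k ≤ n) (x : Fin n → ℝ) :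
    Matrix.vecMulVec x x ∈ Sz n k ↔ sparsity x ≤ k :=
  ⟨sparsity_le_of_vecMulVec_mem_Sz, vecMulVec_mem_Sz_of_sparsity_le hkn⟩
end

section
/- For $n,k\in\mathbb{N}$ with $k\ge 1$, let $\mathbb{S}^n$ be the space of real symmetric $n\times n$ matrices, write $A\succeq B$ if $A-B$ is positive semidefinite, and let $\operatorname{diag}(X)$ be the diagonal matrix with the same diagonal as $X$. Let $\|x\|_0$ be the number of nonzero entries of $x\in\mathbb{R}^n$ and $\|X\|_1=\sum_{i,j}|X_{ij}|$. Put $$S_{n,k}=\{X\in\mathbb{S}^n: k\operatorname{diag}(X)\succeq X,\ X\succeq 0\},\qquad S^{\ell_1}_{n,k}=\{X\in\mathbb{S}^n:\|X\|_1\le k\operatorname{tr}(X),\ X\succeq 0\},$$ $$Q_{n,k}=\{xx^T: x\in\mathbb{R}^n,\ \|x\|_0\le k\}.$$ For all integers $2\le k<n$ there exists a vector $x\in\mathbb{R}^n$ with $\|x\|_0>k$ such that $xx^T\in S^{\ell_1}_{n,k}$; for $k\ge 3$ one may take $x=(1/k^2,1,2,\dots,k,0,\dots,0)^T$. Consequently,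 for all $2\le k<n$, $S^{\ell_1}_{n,k}$ is not contained in $S_{n,k}$, and $\operatorname{conv}(Q_{n,k})$ is a strict subset of $S^{\ell_1}_{n,k}$. -/
/-- The `k`-spartrahedron: symmetric matrices with `k·diag(X) ⪰ X` and `X ⪰ 0`. Over `ℝ`, symmetry
is part of `Matrix.PosSemidef`. -/
def Spartra (n k : ℕ) : Set (Matrix (Fin n) (Fin n) ℝ) :=
  {X | ((k : ℝ) • Matrix.diagonal (fun i => X i i) - X).PosSemidef ∧ X.PosSemidef}

/-- The set of matrices `x xᵀ` with `‖x‖₀ ≤ k`. -/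
def Qset (n k : ℕ) : Set (Matrix (Fin n) (Fin n) ℝ) :=
  {X | ∃ x : Fin n → ℝ, sparsity x ≤ k ∧ X = Matrix.vecMulVec x x}

/-- The `ℓ₁` relaxation: positive semidefinite matrices with `∑ |X i j| ≤ k · tr X`. -/
def Sone (n k : ℕ) : Set (Matrix (Fin n) (Fin n) ℝ) :=
  {X | (∑ i, ∑ j, |X i j|) ≤ (k : ℝ) * X.trace ∧ X.PosSemidef}

/-- The vector `(1/k², 1, 2, …, k, 0, …, 0)` in `ℝⁿ`. -/
noncomputable def stairVec (n k : ℕ) : Fin n → ℝ := fun i =>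
  if (i : ℕ) = 0 then 1 / (k : ℝ) ^ 2 else if (i : ℕ) ≤ k then ((i : ℕ) : ℝ) else 0

open Matrix Finset in
/-- The quadratic form of `x xᵀ` is the square of `x ⬝ᵥ v`. -/
lemma dotProduct_vecMulVec_self_mulVec {n : ℕ} (x v : Fin n → ℝ) :
    v ⬝ᵥ (vecMulVec x x *ᵥ v) = (∑ i, x i * v i) ^ 2 := by
  simp only [dotProduct, mulVec, vecMulVec_apply, sq, sum_mul, mul_sum]
  refine sum_congr rfl fun i _ => sum_congr rfl fun j _ => by ring

open Matrix Finset in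
lemma dotProduct_smul_diagonal_vecMulVec_sub {n : ℕ} (c : ℝ) (x v : Fin n → ℝ) :
    v ⬝ᵥ ((c • diagonal (fun i => vecMulVec x x i i) - vecMulVec x x) *ᵥ v) =
      c * ∑ i, (x i * v i) ^ 2 - (∑ i, x i * v i) ^ 2 := by
  rw [sub_mulVec, dotProduct_sub, dotProduct_vecMulVec_self_mulVec, smul_mulVec, dotProduct_smul]
  congr 1
  rw [smul_eq_mul]
  congr 1
  simp only [dotProduct, mulVec_diagonal, vecMulVec_apply]
  exact sum_congr rfl fun i _ => by ring

lemma vecMulVec_self_posSemidef {n : ℕ} (x : Fin n → ℝ) :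
    (Matrix.vecMulVec x x).PosSemidef := by
  simpa using Matrix.posSemidef_vecMulVec_self_star x

/-- Cauchy–Schwarz on the support of `x`. -/
lemma sq_sum_le_sparsity_mul {n : ℕ} (x f : Fin n → ℝ) (hf : ∀ i, x i = 0 → f i = 0) :
    (∑ i, f i) ^ 2 ≤ (sparsity x : ℝ) * ∑ i, f i ^ 2 := by
  have h1 : ∑ i with x i ≠ 0, f i = ∑ i, f i :=
    Finset.sum_filter_of_ne fun i _ hi hx => hi (hf i hx)
  have h2 : ∑ i with x i ≠ 0, f i ^ 2 = ∑ i, f i ^ 2 :=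
    Finset.sum_filter_of_ne fun i _ hi hx => hi (by rw [hf i hx]; simp)
  rw [← h1, ← h2]
  exact sq_sum_le_card_mul_sum_sq

lemma sum_abs_vecMulVec_self {n : ℕ} (x : Fin n → ℝ) :
    ∑ i, ∑ j, |Matrix.vecMulVec x x i j| = (∑ i, |x i|) ^ 2 := by
  simp only [Matrix.vecMulVec_apply, abs_mul, sq, Finset.sum_mul_sum]

/-- `x xᵀ` lies in the `ℓ₁` relaxation iff `‖x‖₁² ≤ k ‖x‖₂²`. -/
lemma vecMulVec_self_mem_Sone_iff {n k : ℕ} (x : Fin n → ℝ) :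
    Matrix.vecMulVec x x ∈ Sone n k ↔ (∑ i, |x i|) ^ 2 ≤ (k : ℝ) * ∑ i, x i ^ 2 := by
  have htr : (Matrix.vecMulVec x x).trace = ∑ i, x i ^ 2 := by
    simp [Matrix.trace, Matrix.vecMulVec_apply, sq]
  rw [Sone, Set.mem_ofPred_eq, sum_abs_vecMulVec_self, htr]
  exact and_iff_left (vecMulVec_self_posSemidef x)

/-- `x xᵀ` lies in the `k`-spartrahedron iff `x` has at most `k` nonzero entries. -/
lemma vecMulVec_self_mem_Spartra_iff {n k : ℕ} (x : Fin n → ℝ) :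
    Matrix.vecMulVec x x ∈ Spartra n k ↔ sparsity x ≤ k := by
  constructor
  · intro h
    have h0 := h.1.dotProduct_mulVec_nonneg fun i => (x i)⁻¹
    rw [star_trivial, dotProduct_smul_diagonal_vecMulVec_sub] at h0
    have hx : ∀ i, x i * (x i)⁻¹ = if x i ≠ 0 then 1 else 0 := by
      intro i
      by_cases hi : x i = 0 <;> simp [hi]
    have h1 : ∑ i, x i * (x i)⁻¹ = (sparsity x : ℝ) := by
      simp only [hx, sparsity, Finset.sum_boole]
    have h2 : ∑ i, (x i * (x i)⁻¹) ^ 2 = (sparsity x : ℝ) := by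
      rw [← h1]
      refine Finset.sum_congr rfl fun i _ => ?_
      rw [hx]
      split_ifs <;> simp
    rw [h1, h2] at h0
    by_contra! hlt
    have hlt' : (k : ℝ) < sparsity x := by exact_mod_cast hlt
    have hk : (0 : ℝ) ≤ k := k.cast_nonneg
    nlinarith
  · intro h
    refine ⟨.of_dotProduct_mulVec_nonneg ?_ fun v => ?_, vecMulVec_self_posSemidef x⟩
    · exact ((Matrix.isHermitian_diagonal _).smul (IsSelfAdjoint.all _)).sub
        (vecMulVec_self_posSemidef x).1
    · rw [star_trivial, dotProduct_smul_diagonal_vecMulVec_sub, sub_nonneg]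
      refine (sq_sum_le_sparsity_mul x _ fun i hi => by simp [hi]).trans ?_
      gcongr

lemma convex_Spartra (n k : ℕ) : Convex ℝ (Spartra n k) := by
  intro X hX Y hY a b ha hb _
  refine ⟨?_, (hX.2.smul ha).add (hY.2.smul hb)⟩
  convert (hX.1.smul ha).add (hY.1.smul hb) using 1
  ext i j
  by_cases hij : i = j
  · subst hij; simp; ring
  · simp [hij]; ring

lemma convex_Sone (n k : ℕ) : Convex ℝ (Sone n k) := by
  intro X hX Y hY a b ha hb _
  refine ⟨?_, (hX.2.smul ha).add (hY.2.smul hb)⟩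
  calc ∑ i, ∑ j, |(a • X + b • Y) i j|
      ≤ ∑ i, ∑ j, (a * |X i j| + b * |Y i j|) := by
        refine Finset.sum_le_sum fun i _ => Finset.sum_le_sum fun j _ => ?_
        refine (abs_add_le _ _).trans_eq ?_
        simp [abs_mul, abs_of_nonneg ha, abs_of_nonneg hb]
    _ = a * ∑ i, ∑ j, |X i j| + b * ∑ i, ∑ j, |Y i j| := by
        simp only [Finset.sum_add_distrib, Finset.mul_sum]
    _ ≤ a * (k * X.trace) + b * (k * Y.trace) := by
        gcongr
        exacts [hX.1, hY.1]
    _ = k * (a • X + b • Y).trace := by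
        simp only [Matrix.trace_add, Matrix.trace_smul, smul_eq_mul]
        ring

lemma convexHull_Qset_subset_Spartra (n k : ℕ) : convexHull ℝ (Qset n k) ⊆ Spartra n k := by
  refine convexHull_min ?_ (convex_Spartra n k)
  rintro _ ⟨x, hx, rfl⟩
  exact (vecMulVec_self_mem_Spartra_iff x).2 hx

lemma convexHull_Qset_subset_Sone (n k : ℕ) : convexHull ℝ (Qset n k) ⊆ Sone n k := by
  refine convexHull_min ?_ (convex_Sone n k)
  rintro _ ⟨x, hx, rfl⟩
  rw [vecMulVec_self_mem_Sone_iff]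
  refine (sq_sum_le_sparsity_mul x _ fun i hi => by simp [hi]).trans ?_
  simp only [sq_abs]
  gcongr

lemma sum_fin_eq_sum_range_of_support {n m : ℕ} (hmn : m ≤ n) (f : ℕ → ℝ)
    (hf : ∀ i, m ≤ i → f i = 0) : ∑ i : Fin n, f i = ∑ i ∈ Finset.range m, f i := by
  rw [Fin.sum_univ_eq_sum_range]
  refine (Finset.sum_subset (Finset.range_mono hmn) fun i _ hi => hf i ?_).symm
  simpa using hi

lemma lt_sparsity_of_forall_le {n k : ℕ} (hkn : k < n) (x : Fin n → ℝ)
    (hx : ∀ i : Fin n, (i : ℕ) ≤ k → x i ≠ 0) : k < sparsity x := by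
  have h : Finset.Iic (⟨k, hkn⟩ : Fin n) ⊆ Finset.univ.filter fun i => x i ≠ 0 := by
    intro i hi
    exact Finset.mem_filter.2 ⟨Finset.mem_univ i, hx i (Fin.le_def.1 (Finset.mem_Iic (a := ⟨k, hkn⟩).1 hi))⟩
  have := Finset.card_le_card h
  rw [Fin.card_Iic] at this
  exact this

lemma lt_sparsity_stairVec {n k : ℕ} (hk : 1 ≤ k) (hkn : k < n) :
    k < sparsity (stairVec n k) := by
  refine lt_sparsity_of_forall_le hkn _ fun i hi => ?_
  unfold stairVec
  split_ifs with h
  · positivity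
  · exact_mod_cast h

lemma stairVec_nonneg (n k : ℕ) (i : Fin n) : 0 ≤ stairVec n k i := by
  unfold stairVec
  split_ifs <;> positivity

lemma sum_comp_stairVec {n k : ℕ} (hkn : k < n) (g : ℝ → ℝ) (hg : g 0 = 0) :
    ∑ i, g (stairVec n k i) =
      ∑ i ∈ Finset.range k, g ((i : ℝ) + 1) + g (1 / (k : ℝ) ^ 2) := by
  have h := sum_fin_eq_sum_range_of_support (Nat.succ_le_of_lt hkn)
    (fun i : ℕ => g (if i = 0 then 1 / (k : ℝ) ^ 2 else if i ≤ k then (i : ℝ) else 0))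
    (fun i hi => by
      have h0 : i ≠ 0 := by omega
      have h1 : ¬ i ≤ k := by omega
      simp [h0, h1, hg])
  refine h.trans ?_
  rw [Finset.sum_range_succ']
  congr 1
  refine Finset.sum_congr rfl fun i hi => ?_
  have h1 : i + 1 ≤ k := Finset.mem_range.1 hi
  simp [h1]

lemma sum_range_cast_add_one (k : ℕ) :
    ∑ i ∈ Finset.range k, ((i : ℝ) + 1) = (k : ℝ) * (k + 1) / 2 := by
  induction k with
  | zero => simp
  | succ m ih => rw [Finset.sum_range_succ, ih]; push_cast; ring

lemma sum_range_cast_add_one_sq (k : ℕ) :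
    ∑ i ∈ Finset.range k, ((i : ℝ) + 1) ^ 2 = (k : ℝ) * (k + 1) * (2 * k + 1) / 6 := by
  induction k with
  | zero => simp
  | succ m ih => rw [Finset.sum_range_succ, ih]; push_cast; ring

lemma vecMulVec_stairVec_mem_Sone {n k : ℕ} (hk : 3 ≤ k) (hkn : k < n) :
    Matrix.vecMulVec (stairVec n k) (stairVec n k) ∈ Sone n k := by
  rw [vecMulVec_self_mem_Sone_iff]
  simp only [abs_of_nonneg (stairVec_nonneg n k _)]
  have h1 := sum_comp_stairVec hkn (fun t => t) rfl
  have h2 := sum_comp_stairVec hkn (fun t => t ^ 2) (by simp)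
  simp only [sum_range_cast_add_one, sum_range_cast_add_one_sq] at h1 h2
  rw [h1, h2]
  have hk3 : (3 : ℝ) ≤ k := by exact_mod_cast hk
  generalize (k : ℝ) = r at hk3
  have hr : 0 < r := by linarith
  have hinv : r⁻¹ ≤ 1 := inv_le_one_of_one_le₀ (by linarith)
  have hpos : 0 < r⁻¹ := inv_pos.2 hr
  have hrhs : r * (r * (r + 1) * (2 * r + 1) / 6 + (1 / r ^ 2) ^ 2)
      - (r * (r + 1) / 2 + 1 / r ^ 2) ^ 2
      = r ^ 2 * (r ^ 2 - 1) / 12 - 1 - r⁻¹ + r⁻¹ ^ 3 - r⁻¹ ^ 4 := by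
    field_simp
    ring
  have h4 : r⁻¹ ^ 4 ≤ r⁻¹ ^ 3 := pow_le_pow_of_le_one hpos.le hinv (by norm_num)
  have h9 : 9 ≤ r ^ 2 := by nlinarith
  have h6 : 72 ≤ r ^ 2 * (r ^ 2 - 1) := by nlinarith
  linarith

/-- For `k = 2`, the vector `(1, 1, 10, 0, …, 0)` is a suitable witness. -/
lemma exists_two_lt_sparsity_mem_Sone {n : ℕ} (hn : 2 < n) :
    ∃ x : Fin n → ℝ, 2 < sparsity x ∧ Matrix.vecMulVec x x ∈ Sone n 2 := by
  let f : ℕ → ℝ := fun i => if i ≤ 1 then 1 else if i = 2 then 10 else 0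
  have hf : ∀ i, 3 ≤ i → f i = 0 := by
    intro i hi
    have h1 : ¬ i ≤ 1 := by omega
    have h2 : i ≠ 2 := by omega
    simp [f, h1, h2]
  refine ⟨fun i => f i, lt_sparsity_of_forall_le hn _ fun i hi => ?_, ?_⟩
  · dsimp only [f]
    split_ifs with h1 h2
    · norm_num
    · norm_num
    · omega
  · rw [vecMulVec_self_mem_Sone_iff,
      sum_fin_eq_sum_range_of_support hn (fun i => |f i|) fun i hi => by simp [hf i hi],
      sum_fin_eq_sum_range_of_support hn (fun i => f i ^ 2) fun i hi => by simp [hf i hi]]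
    norm_num [Finset.sum_range_succ, f]

lemma exists_lt_sparsity_mem_Sone {n k : ℕ} (hk : 2 ≤ k) (hkn : k < n) :
    ∃ x : Fin n → ℝ, k < sparsity x ∧ Matrix.vecMulVec x x ∈ Sone n k := by
  obtain rfl | h3 := hk.eq_or_lt
  · exact exists_two_lt_sparsity_mem_Sone hkn
  · exact ⟨stairVec n k, lt_sparsity_stairVec (by omega) hkn, vecMulVec_stairVec_mem_Sone h3 hkn⟩

theorem Sone_not_subset_spartra (n k : ℕ) (hk : 2 ≤ k) (hkn : k < n) :
    (∃ x : Fin n → ℝ, k < sparsity x ∧ Matrix.vecMulVec x x ∈ Sone n k) ∧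
    (3 ≤ k → k < sparsity (stairVec n k) ∧
      Matrix.vecMulVec (stairVec n k) (stairVec n k) ∈ Sone n k) ∧
    ¬ Sone n k ⊆ Spartra n k ∧
    convexHull ℝ (Qset n k) ⊂ Sone n k := by
  have hex := exists_lt_sparsity_mem_Sone hk hkn
  have hnot : ¬ Sone n k ⊆ Spartra n k := by
    obtain ⟨x, hx, hmem⟩ := hex
    exact fun h => hx.not_ge ((vecMulVec_self_mem_Spartra_iff x).1 (h hmem))
  exact ⟨hex,
    fun h3 => ⟨lt_sparsity_stairVec (by omega) hkn, vecMulVec_stairVec_mem_Sone h3 hkn⟩, hnot,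
    convexHull_Qset_subset_Sone n k,
    fun h => hnot (h.trans (convexHull_Qset_subset_Spartra n k))⟩
end

section
/- Let $A\in\mathbb R^{m\times n}$ have nonzero columns, $y\in\mathbb R^m$, $\alpha\ge 0$ and $1\le k\le n$. Write $\|\cdot\|$ for the Euclidean norm, $\|x\|_0$ for the number of nonzero entries of $x$, and $C\bullet X=\operatorname{tr}(X^TC)$. For a symmetric matrix $X$ let $\operatorname{diag}(X)$ be the diagonal matrix with the same diagonal as $X$, and let $S_{n,k}$ be the set of real symmetric $n\times n$ matrices $X$ with $k\operatorname{diag}(X)\succeq X\succeq 0$. Let $$\rho^*_\alpha:=\min\Big\{\tfrac1m\|Ax-y\|^2+\alpha\|x\|^2:\ x\in\mathbb R^n,\ \|x\|_0\le k\Big\}$$ be the optimal value of sparse ridge regression, let $r^*_0:=\min\{\frac1m\|Ax-y\|^2:\|x\|_0\le k\}$, and let $$\bar\rho^*_\alpha:=\inf\Big\{C_\alpha\bullet\begin{pmatrix}1&x^T\\x&X\end{pmatrix}:\ x\in\mathbb R^n,\ X\in S_{n,k},\ \begin{pmatrix}1&x^T\\x&X\end{pmatrix}\succeq0\Big\},\qquad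 C_\alpha=\tfrac1m(y,\,-A)^T(y,\,-A)+\alpha\begin{pmatrix}0&0\\0&I_n\end{pmatrix},$$ be the optimal value of its semidefinite relaxation. Let $L$ be the largest Euclidean norm of a column of $A$, let $\bar A$ be $A$ with each column rescaled to unit norm, let $\mu(\bar A):=\max_{i\ne j}|\langle \bar a_i,\bar a_j\rangle|$ be the coherence ($0$ if $n=1$), and let $\lambda_{\min}(A^TA)$ be the smallest eigenvalue of $A^TA$. Set $\tau:=1+(k-1)\mu(\bar A)$ and, whenever $\lambda_{\min}(A^TA)+m\alpha>0$, $\eta_\alpha:=L^2/(\lambda_{\min}(A^TA)+m\alpha)$. Then the minima defining $\rho^*_\alpha$ and $r^*_0$ are attained, and $\bar\rho^*_\alpha\le\rho^*_\alpha$. If $\lambda_{\min}(A^TA)+m\alpha>0$, then the infimum defining $\bar\rho^*_\alpha$ is attained as well and $$(1-\tau\eta_\alpha)\frac{\|y\|^2}{m}+\tau\eta_\alpha\, r^*_0\ \le\ \bar\rho^*_\alpha\ \le\ \rho^*_\alpha .$$ Moreover, for $\bar\alpha:=(\tau L^2-\lambda_{\min}(A^TA))/m$ one has $\tau\eta_{\bar\alpha}=1$,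 the optimal values $\rho^*_{\bar\alpha}$ and $\bar\rho^*_{\bar\alpha}$ are attained, and for every $x^*_0$ with $\|x^*_0\|_0\le k$ and $\frac1m\|Ax^*_0-y\|^2=r^*_0$, $$0\ \le\ \rho^*_{\bar\alpha}-\bar\rho^*_{\bar\alpha}\ \le\ \tau\,\frac{L^2}{m}\|x^*_0\|^2\ \le\ k\,\frac{L^2}{m}\|x^*_0\|^2 .$$ -/
open scoped Matrix

namespace SparseRidge

noncomputable section

/-- The Euclidean norm of a real vector. -/
def l2 {ι : Type*} [Fintype ι] (v : ι → ℝ) : ℝ := ‖WithLp.toLp 2 v‖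

/-- The number of nonzero entries of a vector. -/
def l0 {n : ℕ} (x : Fin n → ℝ) : ℕ := (Finset.univ.filter fun i => x i ≠ 0).card

/-- The vectors with at most `k` nonzero entries. -/
def sparseVectors (n k : ℕ) : Set (Fin n → ℝ) := {x | l0 x ≤ k}

/-- The `k`-spartrahedron: `k • diag X ⪰ X ⪰ 0` (symmetry is part of `PosSemidef`). -/
def spartrahedron (n k : ℕ) : Set (Matrix (Fin n) (Fin n) ℝ) :=
  {X | ((k : ℝ) • Matrix.diagonal X.diag - X).PosSemidef ∧ X.PosSemidef}

/-- The trace inner product of matrices. -/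
def traceInner {ι : Type*} [Fintype ι] (C X : Matrix ι ι ℝ) : ℝ := (Xᵀ * C).trace

section Regression

variable {m n : ℕ} (A : Matrix (Fin m) (Fin n) ℝ) (y : Fin m → ℝ)

/-- The mean square error `(1/m) ‖A x - y‖²`. -/
def mse (x : Fin n → ℝ) : ℝ := (1 / (m : ℝ)) * l2 (A *ᵥ x - y) ^ 2

/-- The ridge objective `(1/m) ‖A x - y‖² + α ‖x‖²`. -/
def ridgeObjective (α : ℝ) (x : Fin n → ℝ) : ℝ := mse A y x + α * l2 x ^ 2

/-- The objective values of `k`-sparse least squares. -/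
def sparseMSEValues (k : ℕ) : Set ℝ := mse A y '' sparseVectors n k

/-- The optimal value of `k`-sparse least squares. -/
def sparseMSE (k : ℕ) : ℝ := sInf (sparseMSEValues A y k)

/-- The objective values of sparse ridge regression. -/
def ridgeValues (k : ℕ) (α : ℝ) : Set ℝ := ridgeObjective A y α '' sparseVectors n k

/-- The optimal value of sparse ridge regression. -/
def ridgeOpt (k : ℕ) (α : ℝ) : ℝ := sInf (ridgeValues A y k α)

/-- The matrix `(y, -A)`. -/
def dataMatrix : Matrix (Fin m) (Unit ⊕ Fin n) ℝ :=
  Matrix.fromCols (Matrix.replicateCol Unit y) (-A)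

/-- The objective matrix `(1/m) (y, -A)ᵀ (y, -A) + α [[0, 0], [0, I]]`. -/
def costMatrix (α : ℝ) : Matrix (Unit ⊕ Fin n) (Unit ⊕ Fin n) ℝ :=
  (1 / (m : ℝ)) • ((dataMatrix A y)ᵀ * dataMatrix A y) + α • Matrix.fromBlocks 0 0 0 1

/-- The block matrix `[[1, xᵀ], [x, X]]`. -/
def lifted (x : Fin n → ℝ) (X : Matrix (Fin n) (Fin n) ℝ) :
    Matrix (Unit ⊕ Fin n) (Unit ⊕ Fin n) ℝ :=
  Matrix.fromBlocks 1 (Matrix.replicateRow Unit x) (Matrix.replicateCol Unit x) X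

/-- The objective values of the spartrahedron relaxation of sparse ridge regression. -/
def sdpValues (k : ℕ) (α : ℝ) : Set ℝ :=
  {ρ | ∃ (x : Fin n → ℝ) (X : Matrix (Fin n) (Fin n) ℝ),
    X ∈ spartrahedron n k ∧ (lifted x X).PosSemidef ∧
      ρ = traceInner (costMatrix A y α) (lifted x X)}

/-- The optimal value of the spartrahedron relaxation. -/
def sdpOpt (k : ℕ) (α : ℝ) : ℝ := sInf (sdpValues A y k α)

/-- The matrix `A` with each column divided by its Euclidean norm. -/
def normalizeCols : Matrix (Fin m) (Fin n) ℝ := Matrix.of fun i j => A i j / l2 (A.col j)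

/-- The largest absolute inner product of two distinct columns; with a single column
the supremum is over the empty family and equals `0`. -/
def coherence : ℝ :=
  ⨆ p : {p : Fin n × Fin n // p.1 ≠ p.2}, |A.col p.1.1 ⬝ᵥ A.col p.1.2|

/-- The largest Euclidean norm of a column. -/
def maxColNorm : ℝ := ⨆ j : Fin n, l2 (A.col j)

/-- The smallest eigenvalue of `Aᵀ A` (over `ℝ`, the conjugate transpose `Aᴴ` is `Aᵀ`). -/
def lamMin : ℝ := ⨅ i : Fin n, (Matrix.isHermitian_conjTranspose_mul_self A).eigenvalues i

/-- `τ = 1 + (k - 1) μ`, where `μ` is the coherence of the column-normalized matrix. -/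
def tau (k : ℕ) : ℝ := 1 + ((k : ℝ) - 1) * coherence (normalizeCols A)

/-- `η_α = L² / (λ_min(AᵀA) + m α)`; meaningful when the denominator is nonzero. -/
def eta (α : ℝ) : ℝ := maxColNorm A ^ 2 / (lamMin A + (m : ℝ) * α)

/-- The special regularization parameter `(τ L² - λ_min(AᵀA)) / m`. -/
def alphaBar (k : ℕ) : ℝ := (tau A k * maxColNorm A ^ 2 - lamMin A) / (m : ℝ)

end Regression

end

end SparseRidge

open SparseRidge

open scoped Matrix

namespace SparseRidge

theorem l2_sq {ι : Type*} [Fintype ι] (v : ι → ℝ) : l2 v ^ 2 = v ⬝ᵥ v := by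
  rw [l2, EuclideanSpace.real_norm_sq_eq]
  simp [dotProduct, sq]

theorem l2_nonneg {ι : Type*} [Fintype ι] (v : ι → ℝ) : 0 ≤ l2 v := norm_nonneg _

theorem l2_pos {ι : Type*} [Fintype ι] {v : ι → ℝ} (hv : v ≠ 0) : 0 < l2 v := by
  rw [l2, norm_pos_iff]
  simpa using hv

theorem abs_dotProduct_le {ι : Type*} [Fintype ι] (v w : ι → ℝ) : |v ⬝ᵥ w| ≤ l2 v * l2 w := by
  have h := abs_real_inner_le_norm (WithLp.toLp 2 w) (WithLp.toLp 2 v)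
  rw [EuclideanSpace.inner_toLp_toLp] at h
  simpa [l2, mul_comm] using h

/-! ### Attainment for sparse ridge regression -/

theorem exists_norm_sub_le {V E : Type*} [AddCommGroup V] [Module ℝ V] [FiniteDimensional ℝ V]
    [NormedAddCommGroup E] [InnerProductSpace ℝ E] (f : V →ₗ[ℝ] E) (w : E) :
    ∃ x, ∀ z, ‖f x - w‖ ≤ ‖f z - w‖ := by
  obtain ⟨v, ⟨x, rfl⟩, hv⟩ := f.range.exists_norm_eq_iInf_of_complete_subspace
    (completeSpace_coe_iff_isComplete.mp (FiniteDimensional.complete ℝ f.range)) w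
  refine ⟨x, fun z => ?_⟩
  rw [norm_sub_rev, hv, norm_sub_rev (f z)]
  exact ciInf_le ⟨0, Set.forall_mem_range.2 fun _ => norm_nonneg _⟩
    (⟨f z, ⟨z, rfl⟩⟩ : (f.range : Set E))

/-- The vectors supported in `S`. -/
def supportedIn {n : ℕ} (S : Finset (Fin n)) : Submodule ℝ (Fin n → ℝ) where
  carrier := {x | ∀ i ∉ S, x i = 0}
  add_mem' hx hy i hi := by simp [hx i hi, hy i hi]
  zero_mem' i hi := rfl
  smul_mem' c x hx i hi := by simp [hx i hi]

theorem mem_sparseVectors_of_supportedIn {n k : ℕ} {S : Finset (Fin n)} (hS : S.card ≤ k)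
    {x : Fin n → ℝ} (hx : x ∈ supportedIn S) : x ∈ sparseVectors n k := by
  refine (Finset.card_le_card fun i hi => ?_).trans hS
  by_contra h
  simp [hx i h] at hi

variable {m n : ℕ} (A : Matrix (Fin m) (Fin n) ℝ) (y : Fin m → ℝ)

/-- The ridge objective is the squared distance of a linear image to a fixed vector. -/
theorem ridgeObjective_eq_norm {α : ℝ} (hα : 0 ≤ α) :
    ∃ (f : (Fin n → ℝ) →ₗ[ℝ] EuclideanSpace ℝ (Fin m ⊕ Fin n))
      (w : EuclideanSpace ℝ (Fin m ⊕ Fin n)),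
      ∀ x, ridgeObjective A y α x = ‖f x - w‖ ^ 2 := by
  set B : Matrix (Fin m ⊕ Fin n) (Fin n) ℝ :=
    Matrix.fromRows (√(1 / m) • A) (√α • 1) with hB
  refine ⟨(WithLp.linearEquiv 2 ℝ _).symm.toLinearMap ∘ₗ B.mulVecLin,
    WithLp.toLp 2 (Sum.elim (√(1 / m) • y) 0), fun x => ?_⟩
  rw [EuclideanSpace.real_norm_sq_eq, Fintype.sum_sum_type]
  have h1 : ∀ i : Fin m, (√(1 / m) * (A *ᵥ x) i - √(1 / m) * y i) ^ 2
      = (1 / m) * ((A *ᵥ x - y) i * (A *ᵥ x - y) i) := fun i => by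
    rw [← mul_sub, mul_pow, Real.sq_sqrt (by positivity), sq, Pi.sub_apply]
  have h2 : ∀ i : Fin n, (√α * x i) ^ 2 = α * (x i * x i) := fun i => by
    rw [mul_pow, Real.sq_sqrt hα, sq]
  rw [ridgeObjective, mse, l2_sq, l2_sq]
  simp only [dotProduct, Finset.mul_sum, ← h1, ← h2]
  simp [hB, Matrix.fromRows_mulVec, Matrix.smul_mulVec]

theorem exists_isLeast_ridgeValues (k : ℕ) {α : ℝ} (hα : 0 ≤ α) :
    ∃ a, IsLeast (ridgeValues A y k α) a := by
  obtain ⟨f, w, hf⟩ := ridgeObjective_eq_norm A y hα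
  choose g hg using fun S : Finset (Fin n) =>
    exists_norm_sub_le (f ∘ₗ (supportedIn S).subtype) w
  obtain ⟨S, hS, hmin⟩ := Finset.exists_min_image
    (Finset.univ.filter fun S : Finset (Fin n) => S.card ≤ k)
    (fun S => ridgeObjective A y α (g S)) ⟨∅, by simp⟩
  refine ⟨_, ⟨g S, mem_sparseVectors_of_supportedIn (by simpa using hS) (g S).2, rfl⟩, ?_⟩
  rintro _ ⟨x, hx, rfl⟩
  set T := Finset.univ.filter fun i => x i ≠ 0 with hT
  refine (hmin T (by simpa using show T.card ≤ k from hx)).trans ?_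
  rw [hf, hf]
  have := hg T ⟨x, fun i hi => by simpa [hT] using hi⟩
  exact pow_le_pow_left₀ (norm_nonneg _) this 2

theorem isLeast_ridgeOpt (k : ℕ) {α : ℝ} (hα : 0 ≤ α) :
    IsLeast (ridgeValues A y k α) (ridgeOpt A y k α) := by
  obtain ⟨a, ha⟩ := exists_isLeast_ridgeValues A y k hα
  rwa [ridgeOpt, ha.csInf_eq]

theorem isLeast_sparseMSE (k : ℕ) :
    IsLeast (sparseMSEValues A y k) (sparseMSE A y k) := by
  have h : sparseMSEValues A y k = ridgeValues A y k 0 := by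
    simp [sparseMSEValues, ridgeValues, ridgeObjective, Set.image]
  rw [sparseMSE, h]
  exact isLeast_ridgeOpt A y k le_rfl

/-! ### The objective of the relaxation -/

theorem trace_fromBlocks {ι κ : Type*} [Fintype ι] [Fintype κ] (P : Matrix ι ι ℝ)
    (Q : Matrix ι κ ℝ) (R : Matrix κ ι ℝ) (S : Matrix κ κ ℝ) :
    (Matrix.fromBlocks P Q R S).trace = P.trace + S.trace := by
  simp [Matrix.trace, Fintype.sum_sum_type]

theorem traceInner_costMatrix_lifted (α : ℝ) (x : Fin n → ℝ) {X : Matrix (Fin n) (Fin n) ℝ}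
    (hX : X.PosSemidef) :
    traceInner (costMatrix A y α) (lifted x X) =
      (1 / (m : ℝ)) * (y ⬝ᵥ y - 2 * ((Aᵀ *ᵥ y) ⬝ᵥ x) + (A * X * Aᵀ).trace) + α * X.trace := by
  have hXt : Xᵀ = X := by simpa using hX.isHermitian.eq
  have h1 : (dataMatrix A y)ᵀ * dataMatrix A y =
      Matrix.fromBlocks (Matrix.of fun _ _ => y ⬝ᵥ y)
        (Matrix.replicateRow Unit (-(Aᵀ *ᵥ y))) (Matrix.replicateCol Unit (-(Aᵀ *ᵥ y)))
        (Aᵀ * A) := by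
    ext (i | i) (j | j) <;>
      simp [dataMatrix, Matrix.mul_apply, dotProduct, Matrix.mulVec, mul_comm]
  have h2 : (A * X * Aᵀ).trace = (X * (Aᵀ * A)).trace := by
    rw [Matrix.mul_assoc, Matrix.trace_mul_comm, Matrix.mul_assoc]
  rw [traceInner, costMatrix, h1, lifted, Matrix.fromBlocks_transpose, hXt, h2,
    Matrix.mul_add, Matrix.mul_smul, Matrix.mul_smul, Matrix.fromBlocks_multiply,
    Matrix.fromBlocks_multiply, Matrix.trace_add, Matrix.trace_smul, Matrix.trace_smul,
    trace_fromBlocks, trace_fromBlocks]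
  simp only [Matrix.trace_add]
  have h3 : ((Matrix.replicateRow Unit x)ᵀ * Matrix.replicateRow Unit (-(Aᵀ *ᵥ y))).trace
      = -((Aᵀ *ᵥ y) ⬝ᵥ x) := by
    simp [Matrix.trace, Matrix.mul_apply, dotProduct, mul_comm]
  have h4 : ((Matrix.replicateCol Unit x)ᵀ * Matrix.replicateCol Unit (-(Aᵀ *ᵥ y))).trace
      = -((Aᵀ *ᵥ y) ⬝ᵥ x) := by
    simp [Matrix.trace, Matrix.mul_apply, dotProduct, mul_comm]
  have h5 : ((1 : Matrix Unit Unit ℝ)ᵀ * Matrix.of fun _ _ => y ⬝ᵥ y).trace = y ⬝ᵥ y := by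
    simp [Matrix.trace]
  rw [h3, h4, h5]
  simp only [Matrix.mul_zero, Matrix.mul_one, Matrix.trace_zero, smul_eq_mul]
  ring

theorem lifted_vecMulVec_posSemidef (x : Fin n → ℝ) :
    (lifted x (Matrix.vecMulVec x x)).PosSemidef := by
  have : lifted x (Matrix.vecMulVec x x) =
      Matrix.vecMulVec (Sum.elim 1 x) (star (Sum.elim (1 : Unit → ℝ) x)) := by
    ext (i | i) (j | j) <;> simp [lifted, Matrix.vecMulVec_apply]
  rw [this]
  exact Matrix.posSemidef_vecMulVec_self_star _

theorem vecMulVec_mem_spartrahedron {k : ℕ} {x : Fin n → ℝ} (hx : x ∈ sparseVectors n k) :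
    Matrix.vecMulVec x x ∈ spartrahedron n k := by
  have h0 : (Matrix.vecMulVec x x).PosSemidef := by
    simpa using Matrix.posSemidef_vecMulVec_self_star x
  refine ⟨Matrix.PosSemidef.of_dotProduct_mulVec_nonneg ?_ fun v => ?_, h0⟩
  · exact (Matrix.isHermitian_diagonal _).smul (by simp [IsSelfAdjoint]) |>.sub h0.isHermitian
  set S := Finset.univ.filter fun i => x i ≠ 0 with hS
  have h1 : x ⬝ᵥ v = ∑ i ∈ S, x i * v i :=
    (Finset.sum_subset (Finset.subset_univ S) fun i _ hi => by
      have : x i = 0 := by simpa [hS] using hi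
      simp [this]).symm
  have h2 : (x ⬝ᵥ v) ^ 2 ≤ k * ∑ i, (x i * v i) ^ 2 := by
    rw [h1]
    refine (sq_sum_le_card_mul_sum_sq).trans ?_
    have : (S.card : ℝ) ≤ k := by exact_mod_cast hx
    refine mul_le_mul this ?_ (Finset.sum_nonneg fun i _ => sq_nonneg _) (by positivity)
    exact Finset.sum_le_sum_of_subset_of_nonneg (Finset.subset_univ _) fun i _ _ => sq_nonneg _
  have h3 : v ⬝ᵥ (Matrix.vecMulVec x x *ᵥ v) = (x ⬝ᵥ v) ^ 2 := by
    rw [Matrix.vecMulVec_mulVec, dotProduct_smul, dotProduct_comm v x]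
    simp [sq]
  have h4 : v ⬝ᵥ (((k : ℝ) • Matrix.diagonal (Matrix.vecMulVec x x).diag) *ᵥ v)
      = k * ∑ i, (x i * v i) ^ 2 := by
    rw [Matrix.smul_mulVec, dotProduct_smul, smul_eq_mul]
    congr 1
    simp only [dotProduct, Matrix.mulVec_diagonal, Matrix.diag_apply, Matrix.vecMulVec_apply]
    exact Finset.sum_congr rfl fun i _ => by ring
  rw [star_trivial, Matrix.sub_mulVec, dotProduct_sub, h3, h4]
  linarith

theorem traceInner_costMatrix_rankOne (α : ℝ) (x : Fin n → ℝ) :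
    traceInner (costMatrix A y α) (lifted x (Matrix.vecMulVec x x)) = ridgeObjective A y α x := by
  rw [traceInner_costMatrix_lifted A y α x
    (by simpa using Matrix.posSemidef_vecMulVec_self_star x), ridgeObjective, mse, l2_sq, l2_sq,
    Matrix.mul_vecMulVec, Matrix.vecMulVec_mul, Matrix.trace_vecMulVec, Matrix.trace_vecMulVec,
    Matrix.vecMul_transpose, Matrix.mulVec_transpose, ← Matrix.dotProduct_mulVec]
  simp only [sub_dotProduct, dotProduct_sub, dotProduct_comm (A *ᵥ x) y]
  ring

theorem ridgeValues_subset_sdpValues (k : ℕ) (α : ℝ) :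
    ridgeValues A y k α ⊆ sdpValues A y k α := by
  rintro _ ⟨x, hx, rfl⟩
  exact ⟨x, _, vecMulVec_mem_spartrahedron hx, lifted_vecMulVec_posSemidef x,
    (traceInner_costMatrix_rankOne A y α x).symm⟩

end SparseRidge

namespace SparseRidge

variable {m n : ℕ} (A : Matrix (Fin m) (Fin n) ℝ) (y : Fin m → ℝ)

/-! ### The smallest eigenvalue of the Gram matrix -/

open scoped MatrixOrder in
theorem trace_mul_nonneg {ι : Type*} [Fintype ι] [DecidableEq ι] {X G : Matrix ι ι ℝ}
    (hX : X.PosSemidef) (hG : G.PosSemidef) : 0 ≤ (X * G).trace := by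
  obtain ⟨B, rfl⟩ := CStarAlgebra.nonneg_iff_eq_star_mul_self.mp hG.nonneg
  rw [Matrix.star_eq_conjTranspose, ← Matrix.mul_assoc, Matrix.trace_mul_comm, ← Matrix.mul_assoc]
  exact (hX.mul_mul_conjTranspose_same B).trace_nonneg

theorem lamMin_nonneg : 0 ≤ lamMin A :=
  Real.iInf_nonneg fun i => Matrix.eigenvalues_conjTranspose_mul_self_nonneg A i

theorem gram_sub_lamMin_posSemidef : (Aᵀ * A - lamMin A • 1).PosSemidef := by
  have hH := Matrix.isHermitian_conjTranspose_mul_self A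
  set U := hH.eigenvectorUnitary
  have h1 : Aᵀ * A - lamMin A • 1 = (U : Matrix (Fin n) (Fin n) ℝ) *
      Matrix.diagonal (fun i => hH.eigenvalues i - lamMin A) *
      (U : Matrix (Fin n) (Fin n) ℝ)ᴴ := by
    have h2 := hH.spectral_theorem
    rw [Unitary.conjStarAlgAut_apply] at h2
    have h3 : (U : Matrix (Fin n) (Fin n) ℝ) * (U : Matrix (Fin n) (Fin n) ℝ)ᴴ = 1 :=
      Unitary.coe_mul_star_self U
    have h4 : Matrix.diagonal (fun i => hH.eigenvalues i - lamMin A) =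
        Matrix.diagonal hH.eigenvalues - lamMin A • (1 : Matrix (Fin n) (Fin n) ℝ) := by
      ext i j
      by_cases h : i = j <;> simp [h]
    rw [h4, Matrix.mul_sub, Matrix.sub_mul, Matrix.mul_smul, Matrix.mul_one, Matrix.smul_mul, h3]
    congr 1
  rw [h1]
  refine Matrix.PosSemidef.mul_mul_conjTranspose_same (Matrix.PosSemidef.diagonal fun i => ?_) _
  exact sub_nonneg.2 (ciInf_le (Set.finite_range _).bddBelow i)

theorem lamMin_mul_trace_le {X : Matrix (Fin n) (Fin n) ℝ} (hX : X.PosSemidef) :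
    lamMin A * X.trace ≤ (A * X * Aᵀ).trace := by
  have h := trace_mul_nonneg hX (gram_sub_lamMin_posSemidef A)
  rw [Matrix.mul_sub, Matrix.trace_sub, Matrix.mul_smul, Matrix.mul_one, Matrix.trace_smul,
    smul_eq_mul, ← Matrix.mul_assoc, Matrix.trace_mul_comm, ← Matrix.mul_assoc] at h
  linarith

theorem lamMin_le_col_sq (j : Fin n) : lamMin A ≤ l2 (A.col j) ^ 2 := by
  have h := (gram_sub_lamMin_posSemidef A).diag_nonneg (i := j)
  have h1 : (Aᵀ * A) j j = l2 (A.col j) ^ 2 := by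
    rw [l2_sq]; rfl
  simp only [Matrix.sub_apply, h1, Matrix.smul_apply, Matrix.one_apply_eq, smul_eq_mul] at h
  linarith

/-! ### Feasible points of the relaxation -/

section Feasible

variable {x : Fin n → ℝ} {X : Matrix (Fin n) (Fin n) ℝ}

theorem sq_dotProduct_le_of_lifted (h : (lifted x X).PosSemidef) (v : Fin n → ℝ) :
    (x ⬝ᵥ v) ^ 2 ≤ v ⬝ᵥ (X *ᵥ v) := by
  have h1 := h.dotProduct_mulVec_nonneg (Sum.elim (fun _ => -(x ⬝ᵥ v)) v)
  have h2 : (Matrix.replicateCol Unit x) *ᵥ (fun _ => -(x ⬝ᵥ v)) = (-(x ⬝ᵥ v)) • x := by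
    ext i
    simp [Matrix.mulVec, dotProduct, mul_comm]
  rw [star_trivial, lifted, Matrix.fromBlocks_mulVec] at h1
  simp only [Sum.elim_comp_inl, Sum.elim_comp_inr, Matrix.one_mulVec, h2,
    sumElim_dotProduct_sumElim, dotProduct_add, dotProduct_smul, smul_eq_mul] at h1
  have h3 : (fun _ : Unit => -(x ⬝ᵥ v)) ⬝ᵥ (fun _ : Unit => -(x ⬝ᵥ v)) = (x ⬝ᵥ v) ^ 2 := by
    simp [dotProduct, sq]
  have h4 : (fun _ : Unit => -(x ⬝ᵥ v)) ⬝ᵥ (Matrix.replicateRow Unit x *ᵥ v)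
      = -(x ⬝ᵥ v) ^ 2 := by
    simp [dotProduct, Matrix.mulVec, sq]
  rw [h3, h4, dotProduct_comm v x] at h1
  nlinarith

theorem sq_le_diag_of_lifted (h : (lifted x X).PosSemidef) (i : Fin n) : x i ^ 2 ≤ X i i := by
  simpa using sq_dotProduct_le_of_lifted h (Pi.single i 1)

theorem sum_sq_div_diag_le {k : ℕ} (hX : X ∈ spartrahedron n k)
    (h : (lifted x X).PosSemidef) : ∑ i, x i ^ 2 / X i i ≤ k := by
  set T := ∑ i, x i ^ 2 / X i i with hT
  set v : Fin n → ℝ := fun i => x i / X i i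
  have h1 : x ⬝ᵥ v = T := Finset.sum_congr rfl fun i _ => by simp only [v]; ring
  have h2 := sq_dotProduct_le_of_lifted h v
  have h3 := hX.1.dotProduct_mulVec_nonneg v
  have h4 : v ⬝ᵥ (((k : ℝ) • Matrix.diagonal X.diag) *ᵥ v) = k * T := by
    rw [Matrix.smul_mulVec, dotProduct_smul, smul_eq_mul]
    congr 1
    refine Finset.sum_congr rfl fun i _ => ?_
    simp only [Matrix.mulVec_diagonal, Matrix.diag_apply, v]
    by_cases h0 : X i i = 0
    · simp [h0]
    · field_simp
  rw [star_trivial, Matrix.sub_mulVec, dotProduct_sub, h4] at h3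
  rw [h1] at h2
  by_contra! hlt
  have hk : (0 : ℝ) ≤ k := by positivity
  nlinarith

theorem abs_apply_le_trace (hX : X.PosSemidef) (i j : Fin n) : |X i j| ≤ X.trace := by
  have hs : X j i = X i j := by simpa using hX.isHermitian.apply i j
  have hd : ∀ l, X l l ≤ X.trace := fun l =>
    Finset.single_le_sum (f := fun l => X l l) (fun l _ => hX.diag_nonneg) (Finset.mem_univ l)
  have hq : ∀ c : ℝ, 0 ≤ X i i + 2 * c * X i j + c ^ 2 * X j j := fun c => by
    have := hX.dotProduct_mulVec_nonneg (Pi.single i 1 + c • Pi.single j 1)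
    simp [Matrix.mulVec_add, Matrix.mulVec_smul, add_dotProduct, hs] at this
    linarith
  have h1 := hq 1
  have h2 := hq (-1)
  have h3 := hd i
  have h4 := hd j
  rw [abs_le]
  constructor <;> linarith

theorem traceInner_costMatrix_lifted_ge (hm : 0 < m) (α : ℝ) (hX : X.PosSemidef) :
    (1 / (m : ℝ)) * (y ⬝ᵥ y - 2 * ((Aᵀ *ᵥ y) ⬝ᵥ x) + (lamMin A + m * α) * X.trace)
      ≤ traceInner (costMatrix A y α) (lifted x X) := by
  have hm' : (0 : ℝ) < m := by exact_mod_cast hm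
  rw [traceInner_costMatrix_lifted A y α x hX]
  have h : α * X.trace = (1 / (m : ℝ)) * (m * α * X.trace) := by field_simp
  rw [h, ← mul_add]
  refine mul_le_mul_of_nonneg_left ?_ (by positivity)
  linarith [lamMin_mul_trace_le A hX]

end Feasible

theorem sdpValues_nonneg (k : ℕ) {α : ℝ} (hα : 0 ≤ α) :
    ∀ ρ ∈ sdpValues A y k α, 0 ≤ ρ := by
  rintro _ ⟨x, X, -, hL, rfl⟩
  have hC : (costMatrix A y α).PosSemidef := by
    refine Matrix.PosSemidef.add (Matrix.PosSemidef.smul ?_ (by positivity))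
      (Matrix.PosSemidef.smul ?_ hα)
    · simpa using Matrix.posSemidef_conjTranspose_mul_self (dataMatrix A y)
    · have : (Matrix.fromBlocks 0 0 0 1 : Matrix (Unit ⊕ Fin n) (Unit ⊕ Fin n) ℝ) =
          Matrix.diagonal (Sum.elim 0 1) := by
        ext (i | i) (j | j) <;> simp [Matrix.diagonal_apply, Matrix.one_apply]
      rw [this]
      exact Matrix.PosSemidef.diagonal (by rintro (i | i) <;> simp)
  exact trace_mul_nonneg hL.transpose hC

theorem sdpOpt_le_ridgeOpt (k : ℕ) {α : ℝ} (hα : 0 ≤ α) : sdpOpt A y k α ≤ ridgeOpt A y k α :=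
  csInf_le ⟨0, sdpValues_nonneg A y k hα⟩
    (ridgeValues_subset_sdpValues A y k α (isLeast_ridgeOpt A y k hα).1)

/-! ### Attainment for the relaxation -/

theorem isCompact_bounded_feasible (k : ℕ) (R : ℝ) :
    IsCompact {p : (Fin n → ℝ) × Matrix (Fin n) (Fin n) ℝ |
      p.2 ∈ spartrahedron n k ∧ (lifted p.1 p.2).PosSemidef ∧ p.2.trace ≤ R} := by
  have hpsd : ∀ {ι : Type} [Fintype ι], IsClosed {M : Matrix ι ι ℝ | M.PosSemidef} := by
    intro ι _
    simp only [Matrix.posSemidef_iff_dotProduct_mulVec, Matrix.IsHermitian]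
    refine IsClosed.and (isClosed_eq (by fun_prop) (by fun_prop)) ?_
    simp only [Set.ofPred_forall]
    exact isClosed_iInter fun v => isClosed_le continuous_const (by fun_prop)
  have hK : IsCompact ((Set.univ.pi fun _ : Fin n => Set.Icc (-(R + 1)) (R + 1)) ×ˢ
      ((Set.univ.pi fun _ : Fin n => Set.univ.pi fun _ : Fin n => Set.Icc (-R) R :
        Set (Fin n → Fin n → ℝ)) : Set (Matrix (Fin n) (Fin n) ℝ))) :=
    (isCompact_univ_pi fun _ => isCompact_Icc).prod
      (isCompact_univ_pi fun _ => isCompact_univ_pi fun _ => isCompact_Icc)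
  refine hK.of_isClosed_subset ?_ ?_
  · refine IsClosed.and (IsClosed.and ?_ ?_) (IsClosed.and ?_ ?_)
    · exact hpsd.preimage
        (f := fun p : (Fin n → ℝ) × Matrix (Fin n) (Fin n) ℝ =>
          (k : ℝ) • Matrix.diagonal p.2.diag - p.2) (by fun_prop)
    · exact hpsd.preimage continuous_snd
    · refine hpsd.preimage
        (f := fun p : (Fin n → ℝ) × Matrix (Fin n) (Fin n) ℝ => lifted p.1 p.2) ?_
      unfold lifted
      fun_prop
    · exact isClosed_le (by fun_prop) continuous_const
  · rintro ⟨x, X⟩ ⟨hX, hL, hR⟩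
    have hb := fun i j => abs_le.1 ((abs_apply_le_trace hX.2 i j).trans hR)
    refine ⟨fun i _ => ?_, fun i _ j _ => hb i j⟩
    have h1 := (sq_le_diag_of_lifted hL i).trans (hb i i).2
    constructor <;> dsimp only <;> nlinarith

/-- Feasible points of large trace are no better than zero. -/
theorem le_traceInner_costMatrix_of_trace_ge (hm : 0 < m) {α : ℝ} (hlam : 0 < lamMin A + m * α)
    {x : Fin n → ℝ} {X : Matrix (Fin n) (Fin n) ℝ} (hX : X.PosSemidef)
    (hL : (lifted x X).PosSemidef)
    (htr : 4 * ((Aᵀ *ᵥ y) ⬝ᵥ (Aᵀ *ᵥ y)) / (lamMin A + m * α) ^ 2 ≤ X.trace) :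
    (1 / (m : ℝ)) * (y ⬝ᵥ y) ≤ traceInner (costMatrix A y α) (lifted x X) := by
  refine le_trans ?_ (traceInner_costMatrix_lifted_ge A y hm α hX)
  refine mul_le_mul_of_nonneg_left ?_ (by positivity)
  generalize lamMin A + m * α = lam at *
  generalize Aᵀ *ᵥ y = b at *
  have h1 : ∀ i, 2 * (b i * x i) ≤ (2 / lam) * (b i * b i) + (lam / 2) * X i i := fun i => by
    have h2 := sq_le_diag_of_lifted hL i
    have h3 : 0 ≤ (lam / 2) * (x i - (2 / lam) * b i) ^ 2 := by positivity
    have h4 : (lam / 2) * (x i - (2 / lam) * b i) ^ 2 =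
        (lam / 2) * x i ^ 2 - 2 * (b i * x i) + (2 / lam) * (b i * b i) := by
      field_simp
      ring
    linarith [mul_le_mul_of_nonneg_left h2 (by positivity : (0 : ℝ) ≤ lam / 2)]
  have h2 : 2 * (b ⬝ᵥ x) ≤ (2 / lam) * (b ⬝ᵥ b) + (lam / 2) * X.trace := by
    simp only [dotProduct, Matrix.trace, Finset.mul_sum, ← Finset.sum_add_distrib]
    exact Finset.sum_le_sum fun i _ => h1 i
  have h3 : (2 / lam) * (b ⬝ᵥ b) = (lam / 2) * (4 * (b ⬝ᵥ b) / lam ^ 2) := by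
    field_simp
    ring
  have h4 := mul_le_mul_of_nonneg_left htr (by positivity : 0 ≤ lam / 2)
  linarith

theorem isLeast_sdpOpt (hm : 0 < m) (k : ℕ) {α : ℝ} (hlam : 0 < lamMin A + m * α) :
    IsLeast (sdpValues A y k α) (sdpOpt A y k α) := by
  set R := 4 * ((Aᵀ *ᵥ y) ⬝ᵥ (Aᵀ *ᵥ y)) / (lamMin A + m * α) ^ 2 with hR
  have hR0 : 0 ≤ R := by
    rw [hR, ← l2_sq]
    positivity
  have hz : (0 : Fin n → ℝ) ∈ sparseVectors n k := by simp [sparseVectors, l0]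
  have hz1 : (0 : Matrix (Fin n) (Fin n) ℝ) ∈ spartrahedron n k := by
    simpa using vecMulVec_mem_spartrahedron hz
  have hz2 : (lifted (0 : Fin n → ℝ) 0).PosSemidef := by
    simpa using lifted_vecMulVec_posSemidef (0 : Fin n → ℝ)
  have hFz : traceInner (costMatrix A y α) (lifted 0 0) = (1 / (m : ℝ)) * (y ⬝ᵥ y) := by
    simp [traceInner_costMatrix_lifted A y α 0 Matrix.PosSemidef.zero]
  have hFc : Continuous fun p : (Fin n → ℝ) × Matrix (Fin n) (Fin n) ℝ =>
      traceInner (costMatrix A y α) (lifted p.1 p.2) := by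
    unfold traceInner lifted
    fun_prop
  have hz3 : (0 : Matrix (Fin n) (Fin n) ℝ).trace ≤ R := by simpa using hR0
  obtain ⟨p, ⟨hp1, hp2, -⟩, hmin⟩ := (isCompact_bounded_feasible (n := n) k R).exists_isMinOn
    ⟨(0, 0), hz1, hz2, hz3⟩ hFc.continuousOn
  rw [isMinOn_iff] at hmin
  have hl : IsLeast (sdpValues A y k α) (traceInner (costMatrix A y α) (lifted p.1 p.2)) := by
    refine ⟨⟨p.1, p.2, hp1, hp2, rfl⟩, ?_⟩
    rintro _ ⟨x, X, hX, hL, rfl⟩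
    by_cases hXR : X.trace ≤ R
    · exact hmin (x, X) ⟨hX, hL, hXR⟩
    · exact (hmin (0, 0) ⟨hz1, hz2, hz3⟩).trans (hFz.trans_le
        (le_traceInner_costMatrix_of_trace_ge A y hm hlam hX.2 hL (not_le.1 hXR).le))
  rwa [sdpOpt, hl.csInf_eq]

end SparseRidge

namespace SparseRidge

variable {m n : ℕ} (A : Matrix (Fin m) (Fin n) ℝ) (y : Fin m → ℝ)

/-! ### Coherence -/

theorem coherence_nonneg : 0 ≤ coherence A := Real.iSup_nonneg fun _ => abs_nonneg _

theorem normalizeCols_col_dotProduct (i j : Fin n) :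
    (normalizeCols A).col i ⬝ᵥ (normalizeCols A).col j =
      (A.col i ⬝ᵥ A.col j) / (l2 (A.col i) * l2 (A.col j)) := by
  simp only [dotProduct, Finset.sum_div]
  exact Finset.sum_congr rfl fun l _ => div_mul_div_comm _ _ _ _

variable {A}

theorem coherence_normalizeCols_le_one (hA : ∀ j, A.col j ≠ 0) :
    coherence (normalizeCols A) ≤ 1 := by
  refine Real.iSup_le (fun p => ?_) zero_le_one
  have h1 := l2_pos (hA p.1.1)
  have h2 := l2_pos (hA p.1.2)
  rw [normalizeCols_col_dotProduct, abs_div, abs_of_pos (mul_pos h1 h2),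
    div_le_one (mul_pos h1 h2)]
  exact abs_dotProduct_le _ _

theorem abs_col_dotProduct_le (hA : ∀ j, A.col j ≠ 0) {i j : Fin n} (hij : i ≠ j) :
    |A.col i ⬝ᵥ A.col j| ≤ coherence (normalizeCols A) * (l2 (A.col i) * l2 (A.col j)) := by
  have h1 := mul_pos (l2_pos (hA i)) (l2_pos (hA j))
  rw [← div_le_iff₀ h1, ← abs_of_pos h1, ← abs_div,
    ← normalizeCols_col_dotProduct]
  exact le_ciSup (f := fun p : {p : Fin n × Fin n // p.1 ≠ p.2} =>
    |(normalizeCols A).col p.1.1 ⬝ᵥ (normalizeCols A).col p.1.2|)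
    (Set.finite_range _).bddAbove ⟨(i, j), hij⟩

theorem one_le_tau {k : ℕ} (hk : 1 ≤ k) : 1 ≤ tau A k := by
  have h1 : (1 : ℝ) ≤ k := by exact_mod_cast hk
  have := mul_nonneg (sub_nonneg.2 h1) (coherence_nonneg (normalizeCols A))
  rw [tau]
  linarith

theorem tau_le (hA : ∀ j, A.col j ≠ 0) {k : ℕ} (hk : 1 ≤ k) : tau A k ≤ k := by
  have h1 : (1 : ℝ) ≤ k := by exact_mod_cast hk
  have := mul_le_mul_of_nonneg_left (coherence_normalizeCols_le_one hA) (sub_nonneg.2 h1)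
  rw [tau]
  linarith

/-- Restricted upper bound for the Gram form on sparse vectors. -/
theorem l2_mulVec_sq_le_tau (hA : ∀ j, A.col j ≠ 0) {k : ℕ} {z : Fin n → ℝ}
    (hz : z ∈ sparseVectors n k) :
    l2 (A *ᵥ z) ^ 2 ≤ tau A k * ∑ i, (l2 (A.col i) * z i) ^ 2 := by
  set μ := coherence (normalizeCols A) with hμ
  have hμ0 : 0 ≤ μ := coherence_nonneg _
  set u : Fin n → ℝ := fun i => l2 (A.col i) * z i with hu
  have h1 : l2 (A *ᵥ z) ^ 2 = ∑ i, ∑ j, z i * z j * (A.col i ⬝ᵥ A.col j) := by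
    have h : A *ᵥ z = ∑ i, z i • A.col i := by
      ext l
      simp [Matrix.mulVec, dotProduct, mul_comm]
    rw [l2_sq, h, sum_dotProduct]
    refine Finset.sum_congr rfl fun i _ => ?_
    rw [dotProduct_sum]
    refine Finset.sum_congr rfl fun j _ => ?_
    rw [smul_dotProduct, dotProduct_smul, smul_eq_mul, smul_eq_mul, mul_assoc]
  have h2 : ∀ i j, z i * z j * (A.col i ⬝ᵥ A.col j) ≤
      μ * (|u i| * |u j|) + if i = j then (1 - μ) * u i ^ 2 else 0 := fun i j => by
    by_cases hij : i = j
    · subst hij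
      rw [if_pos rfl, ← l2_sq, ← abs_mul, abs_mul_self]
      simp only [hu]
      exact le_of_eq (by ring)
    · rw [if_neg hij, add_zero]
      refine (le_abs_self _).trans ?_
      rw [abs_mul, abs_mul]
      refine (mul_le_mul_of_nonneg_left (abs_col_dotProduct_le hA hij)
        (by positivity)).trans_eq ?_
      simp only [hu, abs_mul, abs_of_nonneg (l2_nonneg _)]
      ring
  have h3 : (∑ i, |u i|) ^ 2 ≤ k * ∑ i, u i ^ 2 := by
    set S := Finset.univ.filter fun i => z i ≠ 0 with hS
    have h4 : ∑ i, |u i| = ∑ i ∈ S, |u i| :=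
      (Finset.sum_subset (Finset.subset_univ S) fun i _ hi => by
        have : z i = 0 := by simpa [hS] using hi
        simp [hu, this]).symm
    rw [h4]
    refine (sq_sum_le_card_mul_sum_sq).trans ?_
    have : (S.card : ℝ) ≤ k := by exact_mod_cast hz
    simp only [sq_abs]
    refine mul_le_mul this ?_ (Finset.sum_nonneg fun i _ => sq_nonneg _) (by positivity)
    exact Finset.sum_le_sum_of_subset_of_nonneg (Finset.subset_univ _) fun i _ _ => sq_nonneg _
  have h4 : l2 (A *ᵥ z) ^ 2 ≤ μ * (∑ i, |u i|) ^ 2 + (1 - μ) * ∑ i, u i ^ 2 := by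
    rw [h1]
    refine (Finset.sum_le_sum fun i _ => Finset.sum_le_sum fun j _ => h2 i j).trans_eq ?_
    rw [sq (∑ i, |u i|), Finset.sum_mul_sum]
    simp only [Finset.sum_add_distrib, Finset.sum_ite_eq, Finset.mem_univ, if_true,
      Finset.mul_sum]
  have h5 := mul_le_mul_of_nonneg_left h3 hμ0
  rw [tau, ← hμ]
  linarith

/-! ### The lower bound -/

/-- Fractional selection of total weight at most `k` is dominated by some `k`-subset. -/
theorem exists_card_eq_sum_mul_le {ι : Type*} [Fintype ι] {c t : ι → ℝ}
    {k : ℕ} (hk : 1 ≤ k) (hkn : k ≤ Fintype.card ι) (hc : ∀ i, 0 ≤ c i) (ht0 : ∀ i, 0 ≤ t i)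
    (ht1 : ∀ i, t i ≤ 1) (ht : ∑ i, t i ≤ k) :
    ∃ S : Finset ι, S.card = k ∧ ∑ i, c i * t i ≤ ∑ i ∈ S, c i := by
  classical
  obtain ⟨S, hS, hmax⟩ := Finset.exists_max_image (Finset.univ.powersetCard k)
    (fun S : Finset ι => ∑ i ∈ S, c i) (Finset.powersetCard_nonempty.2 hkn)
  have hcard : S.card = k := (Finset.mem_powersetCard.1 hS).2
  obtain ⟨s, hs, hmin⟩ := Finset.exists_min_image S c (Finset.card_pos.1 (by omega))
  have hout : ∀ j ∉ S, c j ≤ c s := fun j hj => by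
    have hj' : j ∉ S.erase s := fun h => hj (Finset.mem_of_mem_erase h)
    have h := hmax (insert j (S.erase s)) (Finset.mem_powersetCard.2
      ⟨Finset.subset_univ _, by
        rw [Finset.card_insert_of_notMem hj', Finset.card_erase_of_mem hs]; omega⟩)
    rw [Finset.sum_insert hj', ← Finset.add_sum_erase S c hs] at h
    linarith
  refine ⟨S, hcard, ?_⟩
  have h1 : ∑ i, (c i - c s) * t i ≤ ∑ i ∈ S, (c i - c s) := by
    rw [← Finset.sum_filter_add_sum_filter_not Finset.univ (· ∈ S) fun i => (c i - c s) * t i]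
    have h2 : ∑ i with i ∉ S, (c i - c s) * t i ≤ 0 :=
      Finset.sum_nonpos fun i hi => mul_nonpos_of_nonpos_of_nonneg
        (sub_nonpos.2 (hout i (by simpa using hi))) (ht0 i)
    have h3 : ∑ i with i ∈ S, (c i - c s) * t i ≤ ∑ i ∈ S, (c i - c s) := by
      rw [Finset.filter_mem_eq_inter, Finset.univ_inter]
      exact Finset.sum_le_sum fun i hi =>
        mul_le_of_le_one_right (sub_nonneg.2 (hmin i hi)) (ht1 i)
    linarith
  have h4 : ∑ i, (c i - c s) * t i = ∑ i, c i * t i - c s * ∑ i, t i := by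
    simp only [sub_mul, Finset.sum_sub_distrib, Finset.mul_sum]
  have h5 : ∑ i ∈ S, (c i - c s) = ∑ i ∈ S, c i - k * c s := by
    simp [Finset.sum_sub_distrib, hcard]
  have h6 := mul_le_mul_of_nonneg_left ht (hc s)
  linarith

theorem sum_sq_div_le_tau_mul (hA : ∀ j, A.col j ≠ 0) (hm : 0 < m) {k : ℕ} (hk : 1 ≤ k)
    {S : Finset (Fin n)} (hS : S.card ≤ k) :
    ∑ i ∈ S, (Aᵀ *ᵥ y) i ^ 2 / l2 (A.col i) ^ 2 ≤
      tau A k * (l2 y ^ 2 - m * sparseMSE A y k) := by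
  have hm' : (0 : ℝ) < m := by exact_mod_cast hm
  have hτ : 0 < tau A k := zero_lt_one.trans_le (one_le_tau hk)
  set b := Aᵀ *ᵥ y with hb
  set C := ∑ i ∈ S, b i ^ 2 / l2 (A.col i) ^ 2 with hC
  set z : Fin n → ℝ := fun i =>
    if i ∈ S then (tau A k)⁻¹ * (b i / l2 (A.col i) ^ 2) else 0 with hz
  have hzS : z ∈ sparseVectors n k :=
    mem_sparseVectors_of_supportedIn hS fun i hi => by simp [hz, hi]
  have h1 : sparseMSE A y k ≤ mse A y z := (isLeast_sparseMSE A y k).2 ⟨z, hzS, rfl⟩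
  have h2 : l2 (A *ᵥ z - y) ^ 2 = l2 (A *ᵥ z) ^ 2 - 2 * (b ⬝ᵥ z) + l2 y ^ 2 := by
    rw [l2_sq, l2_sq, l2_sq, hb, Matrix.mulVec_transpose, ← Matrix.dotProduct_mulVec]
    simp only [sub_dotProduct, dotProduct_sub, dotProduct_comm (A *ᵥ z) y]
    ring
  have h3 : b ⬝ᵥ z = (tau A k)⁻¹ * C := by
    simp only [dotProduct, hz, mul_ite, mul_zero, Finset.sum_ite_mem, Finset.univ_inter, hC,
      Finset.mul_sum]
    exact Finset.sum_congr rfl fun i _ => by ring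
  have h4 : ∑ i, (l2 (A.col i) * z i) ^ 2 = (tau A k)⁻¹ ^ 2 * C := by
    simp only [hz, mul_ite, mul_zero, ite_pow, ne_eq, OfNat.ofNat_ne_zero, not_false_eq_true,
      zero_pow, Finset.sum_ite_mem, Finset.univ_inter, hC, Finset.mul_sum]
    refine Finset.sum_congr rfl fun i _ => ?_
    have := (l2_pos (hA i)).ne'
    field_simp
  have h5 := l2_mulVec_sq_le_tau hA hzS
  have h6 : tau A k * ((tau A k)⁻¹ ^ 2 * C) = (tau A k)⁻¹ * C := by field_simp
  rw [h4, h6] at h5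
  rw [mse, h2, h3] at h1
  have h7 : m * sparseMSE A y k ≤ l2 y ^ 2 - (tau A k)⁻¹ * C := by
    have := mul_le_mul_of_nonneg_left h1 hm'.le
    rw [← mul_assoc, mul_one_div_cancel hm'.ne', one_mul] at this
    linarith
  have h8 := mul_le_mul_of_nonneg_left h7 hτ.le
  have h9 : tau A k * ((tau A k)⁻¹ * C) = C := by field_simp
  rw [mul_sub, h9] at h8
  rw [mul_sub]
  linarith

theorem col_norm_le_maxColNorm (j : Fin n) : l2 (A.col j) ≤ maxColNorm A :=
  le_ciSup (f := fun j => l2 (A.col j)) (Set.finite_range _).bddAbove j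

theorem maxColNorm_pos (hn : 0 < n) (hA : ∀ j, A.col j ≠ 0) : 0 < maxColNorm A :=
  (l2_pos (hA ⟨0, hn⟩)).trans_le (col_norm_le_maxColNorm _)

/-- Every feasible value of the relaxation satisfies the coherence lower bound. -/
theorem lower_bound_le_of_feasible (hA : ∀ j, A.col j ≠ 0) (hm : 0 < m) {k : ℕ} (hk : 1 ≤ k)
    (hkn : k ≤ n) {α : ℝ} (hlam : 0 < lamMin A + m * α) {ρ : ℝ} (hρ : ρ ∈ sdpValues A y k α) :
    (1 - tau A k * eta A α) * (l2 y ^ 2 / (m : ℝ)) + tau A k * eta A α * sparseMSE A y k ≤ ρ := by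
  obtain ⟨x, X, hX, hL, rfl⟩ := hρ
  have hm' : (0 : ℝ) < m := by exact_mod_cast hm
  have hM := maxColNorm_pos (by omega) hA
  have hη : 0 < eta A α := div_pos (by positivity) hlam
  have hlam' : lamMin A + m * α = maxColNorm A ^ 2 / eta A α := by
    rw [eta]
    field_simp
  refine le_trans ?_ (traceInner_costMatrix_lifted_ge A y hm α hX.2)
  rw [hlam']
  set η := eta A α
  set b := Aᵀ *ᵥ y with hb
  have hsq := sq_le_diag_of_lifted hL
  have hD : ∀ i, 0 ≤ X i i := fun i => hX.2.diag_nonneg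
  obtain ⟨S, hS, hsum⟩ := exists_card_eq_sum_mul_le (ι := Fin n)
    (c := fun i => b i ^ 2 / l2 (A.col i) ^ 2) (t := fun i => x i ^ 2 / X i i) hk (by simpa)
    (fun i => by positivity) (fun i => div_nonneg (sq_nonneg _) (hD i))
    (fun i => div_le_one_of_le₀ (hsq i) (hD i)) (sum_sq_div_diag_le hX hL)
  have h1 : ∀ i, 2 * (b i * x i) ≤ maxColNorm A ^ 2 / η * X i i +
      η * (b i ^ 2 / l2 (A.col i) ^ 2 * (x i ^ 2 / X i i)) := fun i => by
    have hN := l2_pos (hA i)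
    rcases (hD i).eq_or_lt with h0 | h0
    · have : x i = 0 := by
        have := hsq i
        rw [← h0] at this
        exact pow_eq_zero_iff two_ne_zero |>.1 (le_antisymm this (sq_nonneg _))
      simp [this, ← h0]
    · have h2 : l2 (A.col i) ^ 2 / η * X i i ≤ maxColNorm A ^ 2 / η * X i i := by
        have := col_norm_le_maxColNorm (A := A) i
        gcongr
      have h3 : 0 ≤ (η / (l2 (A.col i) ^ 2 * X i i)) *
          (b i * x i - l2 (A.col i) ^ 2 * X i i / η) ^ 2 := by positivity
      have h4 : (η / (l2 (A.col i) ^ 2 * X i i)) *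
          (b i * x i - l2 (A.col i) ^ 2 * X i i / η) ^ 2 =
          η * (b i ^ 2 / l2 (A.col i) ^ 2 * (x i ^ 2 / X i i)) - 2 * (b i * x i) +
            l2 (A.col i) ^ 2 / η * X i i := by
        field_simp
        ring
      linarith
  have h2 : 2 * (b ⬝ᵥ x) ≤ maxColNorm A ^ 2 / η * X.trace +
      η * ∑ i, b i ^ 2 / l2 (A.col i) ^ 2 * (x i ^ 2 / X i i) := by
    simp only [dotProduct, Matrix.trace, Finset.mul_sum, ← Finset.sum_add_distrib]
    exact Finset.sum_le_sum fun i _ => h1 i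
  have h3 := mul_le_mul_of_nonneg_left
    (hsum.trans (sum_sq_div_le_tau_mul y hA hm hk hS.le)) hη.le
  have h4 : (1 - tau A k * η) * (l2 y ^ 2 / (m : ℝ)) + tau A k * η * sparseMSE A y k =
      (1 / (m : ℝ)) * (l2 y ^ 2 - η * (tau A k * (l2 y ^ 2 - m * sparseMSE A y k))) := by
    field_simp
    ring
  rw [h4, ← l2_sq]
  refine mul_le_mul_of_nonneg_left ?_ (by positivity)
  linarith

end SparseRidge

theorem sparse_ridge_relaxation_gap {m n : ℕ} (k : ℕ) (hk : 1 ≤ k) (hkn : k ≤ n)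
    (A : Matrix (Fin m) (Fin n) ℝ) (hA : ∀ j, A.col j ≠ 0) (y : Fin m → ℝ)
    (α : ℝ) (hα : 0 ≤ α) :
    -- the minima defining `r*₀` and `ρ*_α` are attained
    IsLeast (sparseMSEValues A y k) (sparseMSE A y k) ∧
    IsLeast (ridgeValues A y k α) (ridgeOpt A y k α) ∧
    -- the two bounds; the lower one whenever `η_α` is defined
    (0 < lamMin A + (m : ℝ) * α →
      IsLeast (sdpValues A y k α) (sdpOpt A y k α) ∧
      (1 - tau A k * eta A α) * (l2 y ^ 2 / (m : ℝ)) + tau A k * eta A α * sparseMSE A y k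
        ≤ sdpOpt A y k α) ∧
    sdpOpt A y k α ≤ ridgeOpt A y k α ∧
    -- the special regularization parameter
    tau A k * eta A (alphaBar A k) = 1 ∧
    IsLeast (ridgeValues A y k (alphaBar A k)) (ridgeOpt A y k (alphaBar A k)) ∧
    IsLeast (sdpValues A y k (alphaBar A k)) (sdpOpt A y k (alphaBar A k)) ∧
    ∀ x₀ ∈ sparseVectors n k, mse A y x₀ = sparseMSE A y k →
      0 ≤ ridgeOpt A y k (alphaBar A k) - sdpOpt A y k (alphaBar A k) ∧
      ridgeOpt A y k (alphaBar A k) - sdpOpt A y k (alphaBar A k)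
        ≤ tau A k * (maxColNorm A ^ 2 / (m : ℝ)) * l2 x₀ ^ 2 ∧
      tau A k * (maxColNorm A ^ 2 / (m : ℝ)) * l2 x₀ ^ 2
        ≤ (k : ℝ) * (maxColNorm A ^ 2 / (m : ℝ)) * l2 x₀ ^ 2 := by
  have hn : 0 < n := by omega
  have hm : 0 < m := by
    refine Nat.pos_of_ne_zero fun h => hA ⟨0, hn⟩ ?_
    subst h
    exact Subsingleton.elim _ _
  have hm' : (0 : ℝ) < m := by exact_mod_cast hm
  have hM := maxColNorm_pos hn hA
  have hτ : 1 ≤ tau A k := one_le_tau hk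
  have hlam : lamMin A + m * alphaBar A k = tau A k * maxColNorm A ^ 2 := by
    rw [alphaBar]
    field_simp
    ring
  have hlam_pos : 0 < lamMin A + m * alphaBar A k := by
    rw [hlam]
    positivity
  have hlam_le : lamMin A ≤ maxColNorm A ^ 2 :=
    (lamMin_le_col_sq A ⟨0, hn⟩).trans
      (pow_le_pow_left₀ (l2_nonneg _) (col_norm_le_maxColNorm _) 2)
  have hbar : 0 ≤ alphaBar A k := by
    refine div_nonneg (sub_nonneg.2 (hlam_le.trans ?_)) hm'.le
    exact le_mul_of_one_le_left (by positivity) hτ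
  have hη : tau A k * eta A (alphaBar A k) = 1 := by
    rw [eta, hlam]
    field_simp
  refine ⟨isLeast_sparseMSE A y k, isLeast_ridgeOpt A y k hα, fun h => ?_,
    sdpOpt_le_ridgeOpt A y k hα, hη, isLeast_ridgeOpt A y k hbar,
    isLeast_sdpOpt A y hm k hlam_pos, fun x₀ hx₀ hmse => ⟨?_, ?_, ?_⟩⟩
  · have := isLeast_sdpOpt A y hm k h
    exact ⟨this, lower_bound_le_of_feasible y hA hm hk hkn h this.1⟩
  · exact sub_nonneg.2 (sdpOpt_le_ridgeOpt A y k hbar)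
  · have h1 := lower_bound_le_of_feasible y hA hm hk hkn hlam_pos
      (isLeast_sdpOpt A y hm k hlam_pos).1
    rw [hη, sub_self, zero_mul, zero_add, one_mul] at h1
    have h2 : ridgeOpt A y k (alphaBar A k) ≤ mse A y x₀ + alphaBar A k * l2 x₀ ^ 2 :=
      (isLeast_ridgeOpt A y k hbar).2 ⟨x₀, hx₀, rfl⟩
    have h3 : alphaBar A k ≤ tau A k * (maxColNorm A ^ 2 / m) := by
      rw [alphaBar, ← mul_div_assoc]
      have := lamMin_nonneg A
      gcongr
      linarith
    have h4 := mul_le_mul_of_nonneg_right h3 (sq_nonneg (l2 x₀))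
    linarith
  · have := tau_le hA hk
    gcongr
end
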